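/- arXiv:math/0006119 — 3 statements merged into one kernel-verified Lean document; each statement's English description precedes it below -/
import Mathlib

section
/- For all integers n ≥ 2 and r with 1 ≤ r and 2r ≤ n, and every nonnegative integer k: Σ_{x∈X} Ũ(x)·s₁(x) = 0 and Σ_{x∈X} Q̃^{*k}(x)·s₁(x) = (1 − 2/n)^k; and if moreover r ≥ 2, then Σ_{x∈X} Ũ(x)·s₂(x) = 0 and Σ_{x∈X} Q̃^{*k}(x)·s₂(x) = (1 − 2/n)^{2k}. Here Q̃^{*k} is the probability measure induced on X by the k-fold convolution Q^{*k}. -/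
open scoped Classical Pointwise

noncomputable section

namespace BL

/-- The subgroup of permutations of `Fin n` mapping `{0,…,r−1}` (the "first r positions")
to itself. -/
def blockSubgroup (n r : ℕ) : Subgroup (Equiv.Perm (Fin n)) :=
  MulAction.stabilizer (Equiv.Perm (Fin n)) ({ i : Fin n | (i : ℕ) < r } : Set (Fin n))

instance fintypeQuot {G : Type*} [Group G] [Fintype G] (H : Subgroup G) : Fintype (G ⧸ H) :=
  Fintype.ofFinite _

/-- Convolution of two (signed) measures on a finite group. -/
def conv {G : Type*} [Group G] [Fintype G] (μ ν : G → ℝ) : G → ℝ :=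
  fun g => ∑ h : G, μ h * ν (h⁻¹ * g)

/-- `k`-fold convolution power; `convPow μ 0` is the point mass at the identity. -/
def convPow {G : Type*} [Group G] [Fintype G] (μ : G → ℝ) : ℕ → G → ℝ
  | 0 => fun g => if g = 1 then 1 else 0
  | (k+1) => conv μ (convPow μ k)

/-- The measure induced on the left coset space `G ⧸ H`. -/
def induced {G : Type*} [Group G] [Fintype G] (H : Subgroup G) (μ : G → ℝ) :
    G ⧸ H → ℝ :=
  fun x => ∑ g : G, if (g : G ⧸ H) = x then μ g else 0

/-- Total variation distance. -/
def tv {X : Type*} [Fintype X] (μ ν : X → ℝ) : ℝ := (1/2) * ∑ x : X, |μ x - ν x|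

/-- ℓ² distance. -/
def l2 {X : Type*} [Fintype X] (μ ν : X → ℝ) : ℝ := Real.sqrt (∑ x : X, (μ x - ν x)^2)

/-- Uniform probability measure. -/
def unif (X : Type*) [Fintype X] : X → ℝ := fun _ => 1 / (Fintype.card X)

/-- `π = τκ` with `τ` a transposition crossing between the two blocks and `κ ∈ K`. -/
def crossProp (n r : ℕ) (π : Equiv.Perm (Fin n)) : Prop :=
  ∃ p q : Fin n, (p : ℕ) < r ∧ r ≤ (q : ℕ) ∧
    ∃ κ ∈ blockSubgroup n r, π = Equiv.swap p q * κ

/-- The Bernoulli–Laplace measure `P`. -/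
def P (n r : ℕ) : Equiv.Perm (Fin n) → ℝ := fun π =>
  if crossProp n r π then
    1 / ((r * (n - r) * (Nat.factorial r * Nat.factorial (n - r)) : ℕ) : ℝ)
  else 0

/-- The measure `Q` of the variant model. -/
def Q (n r : ℕ) : Equiv.Perm (Fin n) → ℝ := fun π =>
  if π ∈ blockSubgroup n r then
    ((n^2 - 2*r*(n-r) : ℕ) : ℝ) / ((n^2 * (Nat.factorial r * Nat.factorial (n - r)) : ℕ) : ℝ)
  else if crossProp n r π then
    2 / ((n^2 * (Nat.factorial r * Nat.factorial (n - r)) : ℕ) : ℝ)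
  else 0


/-- Number of fixed points of a permutation. -/
def fixCount {n : ℕ} (π : Equiv.Perm (Fin n)) : ℕ :=
  (Finset.univ.filter fun i => π i = i).card

/-- Number of 2-cycles of a permutation. -/
def twoCycleCount {n : ℕ} (π : Equiv.Perm (Fin n)) : ℕ :=
  Multiset.count 2 π.cycleType

/-- The spherical function `s₁`: for the coset `x = gK`,
`s₁(x) = (1/|K|)·Σ_{h ∈ gK} (fix(h) − 1)`. -/
def s1 (n r : ℕ) : (Equiv.Perm (Fin n) ⧸ blockSubgroup n r) → ℝ := fun x =>
  (∑ g : Equiv.Perm (Fin n),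
      if (g : Equiv.Perm (Fin n) ⧸ blockSubgroup n r) = x then (fixCount g : ℝ) - 1 else 0)
    / ((Nat.factorial r * Nat.factorial (n - r) : ℕ) : ℝ)

/-- The spherical function `s₂`: for the coset `x = gK`,
`s₂(x) = (1/|K|)·Σ_{h ∈ gK} ((1/2)·fix(h)·(fix(h) − 3) + t₂(h))`. -/
def s2 (n r : ℕ) : (Equiv.Perm (Fin n) ⧸ blockSubgroup n r) → ℝ := fun x =>
  (∑ g : Equiv.Perm (Fin n),
      if (g : Equiv.Perm (Fin n) ⧸ blockSubgroup n r) = x then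
        (1/2 : ℝ) * (fixCount g : ℝ) * ((fixCount g : ℝ) - 3) + (twoCycleCount g : ℝ)
      else 0)
    / ((Nat.factorial r * Nat.factorial (n - r) : ℕ) : ℝ)

section Delta

open Equiv Finset

variable {α : Type*} [DecidableEq α]

/-- The Kronecker delta. -/
def delta (a b : α) : ℝ := if a = b then 1 else 0

theorem delta_comm (a b : α) : delta a b = delta b a := by
  simp only [delta, eq_comm]

theorem delta_mul_self (a b : α) : delta a b * delta a b = delta a b := by
  simp [delta]

theorem delta_apply_apply (g : Perm α) (a b : α) : delta (g a) (g b) = delta a b := by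
  simp [delta]

theorem sum_delta_mul {B : Finset α} {c : α} (hc : c ∈ B) (φ : α → ℝ) :
    ∑ i ∈ B, delta i c * φ i = φ c := by
  simp [delta, hc]

theorem sum_delta_mul' {B : Finset α} {c : α} (hc : c ∈ B) (φ : α → ℝ) :
    ∑ i ∈ B, delta c i * φ i = φ c := by
  simp [delta, hc]

theorem sum_delta {B : Finset α} {c : α} (hc : c ∈ B) : ∑ i ∈ B, delta i c = 1 := by
  simp [delta, hc]

theorem sum_delta' {B : Finset α} {c : α} (hc : c ∈ B) : ∑ i ∈ B, delta c i = 1 := by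
  simp [delta, hc]

theorem delta_swap_apply (i j c a : α) :
    delta (swap i j c) a =
      delta c a + delta i c * (delta j a - delta c a) + delta j c * (delta i a - delta c a) := by
  rw [swap_apply_def]
  by_cases h1 : c = i
  · subst h1
    by_cases h2 : j = c
    · subst h2; simp [delta]
    · simp [delta, h2]
  · by_cases h2 : c = j
    · subst h2; simp [delta, h1, Ne.symm h1]
    · simp [delta, h1, h2, Ne.symm h1, Ne.symm h2]

theorem sum_delta_swap_apply {B : Finset α} {c a : α} (hc : c ∈ B) (ha : a ∈ B) :
    ∑ i ∈ B, ∑ j ∈ B, delta (swap i j c) a =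
      ((#B : ℝ) ^ 2 - 2 * #B) * delta c a + 2 := by
  simp only [delta_swap_apply, sum_add_distrib, ← mul_sum, sum_delta_mul hc, sum_const,
    sum_sub_distrib, nsmul_eq_mul, sum_delta ha]
  ring

theorem sum_delta_swap_apply_mul {B : Finset α} {c d a b : α} (hc : c ∈ B) (hd : d ∈ B)
    (ha : a ∈ B) (hb : b ∈ B) :
    ∑ i ∈ B, ∑ j ∈ B, delta (swap i j c) a * delta (swap i j d) b =
      ((#B : ℝ) ^ 2 - 4 * #B) * (delta c a * delta d b) + 2 * delta c a + 2 * delta d b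
      + 2 * (delta c d * (delta a b - delta c a - delta d b + #B * (delta c a * delta d b)))
      + 2 * ((delta d a - delta c a) * (delta c b - delta d b)) := by
  have expand : ∀ i j : α, delta (swap i j c) a * delta (swap i j d) b =
      delta c a * delta d b
      + delta i c * (delta d b * (delta j a - delta c a))
      + delta j c * (delta d b * (delta i a - delta c a))
      + delta i d * (delta c a * (delta j b - delta d b))
      + delta j d * (delta c a * (delta i b - delta d b))
      + delta i c * (delta i d * ((delta j a - delta c a) * (delta j b - delta d b)))
      + delta j c * (delta j d * ((delta i a - delta c a) * (delta i b - delta d b)))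
      + delta i c * (delta j d * ((delta j a - delta c a) * (delta i b - delta d b)))
      + delta j c * (delta i d * ((delta i a - delta c a) * (delta j b - delta d b))) := by
    intro i j
    rw [delta_swap_apply, delta_swap_apply]
    ring
  have pair : ∑ i ∈ B, (delta i a - delta c a) * (delta i b - delta d b) =
      delta a b - delta c a - delta d b + #B * (delta c a * delta d b) := by
    have : ∀ i, (delta i a - delta c a) * (delta i b - delta d b) =
        delta i a * (delta i b - delta d b) - delta c a * (delta i b - delta d b) := by
      intro i; ring
    simp only [this, sum_sub_distrib, ← mul_sum, sum_delta_mul ha, sum_delta hb, sum_const,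
      nsmul_eq_mul]
    ring
  simp only [expand, sum_add_distrib, ← mul_sum, sum_delta_mul hc, sum_delta_mul hd, sum_const,
    sum_sub_distrib, nsmul_eq_mul, sum_delta ha, sum_delta hb, pair]
  ring

theorem sum_comm_three {ι κ : Type*} (s : Finset ι) (t : Finset κ) (φ : ι → ι → κ → ℝ) :
    ∑ i ∈ s, ∑ j ∈ s, ∑ a ∈ t, φ i j a = ∑ a ∈ t, ∑ i ∈ s, ∑ j ∈ s, φ i j a :=
  (sum_congr rfl fun _ _ => sum_comm).trans sum_comm

/-- The number of fixed points of `g` in `B`. -/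
def fixOn (B : Finset α) (g : Perm α) : ℝ := ∑ a ∈ B, delta (g a) a

/-- The number of ordered pairs of elements of `B` fixed by `g` plus the number of those
exchanged by `g`. -/
def pairOn (B : Finset α) (g : Perm α) : ℝ := fixOn B g ^ 2 + fixOn B (g * g)

theorem sum_fixOn_swap_mul {B : Finset α} {g : Perm α} (hg : ∀ a ∈ B, g a ∈ B) :
    ∑ i ∈ B, ∑ j ∈ B, fixOn B (swap i j * g) =
      ((#B : ℝ) ^ 2 - 2 * #B) * fixOn B g + 2 * #B := by
  simp only [fixOn, Perm.mul_apply]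
  rw [sum_comm_three, sum_congr rfl fun a ha => sum_delta_swap_apply (hg a ha) ha, sum_add_distrib,
    ← mul_sum, sum_const, nsmul_eq_mul]
  ring

theorem pairOn_eq_sum {B : Finset α} {g : Perm α} (hg : ∀ a ∈ B, g a ∈ B) :
    pairOn B g = ∑ a ∈ B, ∑ b ∈ B,
      (delta (g a) a * delta (g b) b + delta (g a) b * delta (g b) a) := by
  simp only [sum_add_distrib, pairOn, ← mul_sum, ← sum_mul, pow_two]
  congr 1
  refine sum_congr rfl fun a ha => ?_
  rw [sum_delta_mul' (hg a ha), Perm.mul_apply]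

theorem swap_apply_mem {B : Finset α} {i j a : α} (hi : i ∈ B) (hj : j ∈ B) (ha : a ∈ B) :
    swap i j a ∈ B := by
  rw [swap_apply_def]; split_ifs <;> assumption

theorem sum_pairOn_swap_mul {B : Finset α} {g : Perm α} (hg : ∀ a ∈ B, g a ∈ B) :
    ∑ i ∈ B, ∑ j ∈ B, pairOn B (swap i j * g) =
      ((#B : ℝ) - 2) ^ 2 * pairOn B g + 8 * #B * fixOn B g + 8 * #B - 16 * fixOn B g := by
  have h1 : ∑ i ∈ B, ∑ j ∈ B, pairOn B (swap i j * g) =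
      ∑ a ∈ B, ∑ b ∈ B, ∑ i ∈ B, ∑ j ∈ B,
        (delta (swap i j (g a)) a * delta (swap i j (g b)) b
          + delta (swap i j (g a)) b * delta (swap i j (g b)) a) := by
    refine Eq.trans ?_ ((sum_comm_three B B _).trans (sum_congr rfl fun a _ => sum_comm_three B B _))
    refine sum_congr rfl fun i hi => sum_congr rfl fun j hj => ?_
    exact pairOn_eq_sum (g := swap i j * g) fun a ha => swap_apply_mem hi hj (hg a ha)
  have h2 : ∀ a ∈ B, ∀ b ∈ B, ∑ i ∈ B, ∑ j ∈ B,
        (delta (swap i j (g a)) a * delta (swap i j (g b)) b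
          + delta (swap i j (g a)) b * delta (swap i j (g b)) a) =
      ((#B : ℝ) - 2) ^ 2 * (delta (g a) a * delta (g b) b + delta (g a) b * delta (g b) a)
      + 2 * delta (g a) a + 2 * delta (g b) b + 2 * delta (g a) b + 2 * delta (g b) a
      + 4 * delta a b
      + delta a b * (-2 * delta (g a) a - 2 * delta (g b) b - 2 * delta (g a) b - 2 * delta (g b) a
        + 2 * #B * (delta (g a) a * delta (g b) b + delta (g a) b * delta (g b) a))
      - 4 * (delta (g a) a * delta (g a) b) - 4 * (delta (g b) b * delta (g b) a) := by
    intro a ha b hb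
    simp only [sum_add_distrib]
    rw [sum_delta_swap_apply_mul (hg a ha) (hg b hb) ha hb,
      sum_delta_swap_apply_mul (hg a ha) (hg b hb) hb ha, delta_apply_apply, delta_comm b a]
    have := delta_mul_self a b
    linear_combination (4 : ℝ) * this
  have h3 : ∑ a ∈ B, ∑ b ∈ B, delta (g b) a = #B := by
    rw [sum_comm, sum_congr rfl fun b hb => sum_delta' (hg b hb)]
    simp
  have h4 : ∑ a ∈ B, ∑ b ∈ B, delta (g b) b * delta (g b) a = fixOn B g := by
    rw [sum_comm]
    simp only [← mul_sum]
    exact sum_congr rfl fun b hb => by rw [sum_delta' (hg b hb), mul_one]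
  have h5 : ∑ a ∈ B, ∑ b ∈ B, delta (g a) b = #B := by
    rw [sum_congr rfl fun b hb => sum_delta' (hg b hb)]
    simp
  have h6 : ∑ a ∈ B, delta (g a) a * ∑ b ∈ B, delta (g a) b = fixOn B g :=
    sum_congr rfl fun b hb => by rw [sum_delta' (hg b hb), mul_one]
  have h7 : ∑ a ∈ B, ∑ b ∈ B, delta a b = #B := by
    rw [sum_congr rfl fun b hb => sum_delta' hb]
    simp
  have h8 : ∑ a ∈ B, ∑ b ∈ B,
      delta a b * (-2 * delta (g a) a - 2 * delta (g b) b - 2 * delta (g a) b - 2 * delta (g b) a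
        + 2 * #B * (delta (g a) a * delta (g b) b + delta (g a) b * delta (g b) a)) =
      (4 * #B - 8) * fixOn B g := by
    rw [sum_congr rfl fun a ha => sum_delta_mul' ha _, fixOn, mul_sum]
    refine sum_congr rfl fun a _ => ?_
    linear_combination 4 * (#B : ℝ) * delta_mul_self (g a) a
  rw [h1, sum_congr rfl fun a ha => sum_congr rfl fun b hb => h2 a ha b hb]
  simp only [sum_add_distrib, sum_sub_distrib, h8]
  simp only [mul_assoc, ← mul_sum, h3, h4, h5, h6, h7, sum_const, nsmul_eq_mul, ← fixOn.eq_def]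
  rw [← pairOn_eq_sum hg]
  ring

theorem sum_swap_mul_eq {H : Finset (Perm α)} {i j : α} (hH : ∀ g ∈ H, swap i j * g ∈ H)
    (φ : Perm α → ℝ) : ∑ g ∈ H, φ (swap i j * g) = ∑ g ∈ H, φ g :=
  sum_nbij' (swap i j * ·) (swap i j * ·) hH hH (by simp) (by simp) (by simp)

theorem sum_sum_swap_mul_eq {H : Finset (Perm α)} {B : Finset α}
    (hH : ∀ i ∈ B, ∀ j ∈ B, ∀ g ∈ H, swap i j * g ∈ H) (φ : Perm α → ℝ) :
    ∑ g ∈ H, ∑ i ∈ B, ∑ j ∈ B, φ (swap i j * g) = (#B : ℝ) ^ 2 * ∑ g ∈ H, φ g := by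
  rw [← sum_comm_three, sum_congr rfl fun i hi => sum_congr rfl fun j hj =>
    sum_swap_mul_eq (hH i hi j hj) φ]
  simp only [sum_const, nsmul_eq_mul]
  ring

theorem sum_fixOn_mul {H : Finset (Perm α)} {B : Finset α} (hB : 1 ≤ #B)
    (hH : ∀ i ∈ B, ∀ j ∈ B, ∀ g ∈ H, swap i j * g ∈ H) (hmap : ∀ g ∈ H, ∀ a ∈ B, g a ∈ B)
    (φ : Perm α → ℝ) (hφ : ∀ i ∈ B, ∀ j ∈ B, ∀ g ∈ H, φ (swap i j * g) = φ g) :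
    ∑ g ∈ H, fixOn B g * φ g = ∑ g ∈ H, φ g := by
  have h := sum_sum_swap_mul_eq hH (fun g => fixOn B g * φ g)
  have h' : ∀ g ∈ H, ∑ i ∈ B, ∑ j ∈ B, fixOn B (swap i j * g) * φ (swap i j * g) =
      ((#B : ℝ) ^ 2 - 2 * #B) * (fixOn B g * φ g) + 2 * #B * φ g := by
    intro g hg
    rw [sum_congr rfl fun i hi => sum_congr rfl fun j hj => by rw [hφ i hi j hj g hg]]
    simp only [← sum_mul]
    rw [sum_fixOn_swap_mul (hmap g hg)]
    ring
  rw [sum_congr rfl h', sum_add_distrib, ← mul_sum, ← mul_sum] at h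
  have hm : (2 * (#B : ℝ)) ≠ 0 := by positivity
  exact mul_left_cancel₀ hm (by linear_combination -h)

theorem sum_fixOn {H : Finset (Perm α)} {B : Finset α} (hB : 1 ≤ #B)
    (hH : ∀ i ∈ B, ∀ j ∈ B, ∀ g ∈ H, swap i j * g ∈ H) (hmap : ∀ g ∈ H, ∀ a ∈ B, g a ∈ B) :
    ∑ g ∈ H, fixOn B g = #H := by
  simpa using sum_fixOn_mul hB hH hmap (fun _ => 1) (fun _ _ _ _ _ _ => rfl)

theorem sum_pairOn {H : Finset (Perm α)} {B : Finset α} (hB : 2 ≤ #B)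
    (hH : ∀ i ∈ B, ∀ j ∈ B, ∀ g ∈ H, swap i j * g ∈ H) (hmap : ∀ g ∈ H, ∀ a ∈ B, g a ∈ B) :
    ∑ g ∈ H, pairOn B g = 4 * #H := by
  have h := sum_sum_swap_mul_eq hH (pairOn B)
  rw [sum_congr rfl fun g hg => sum_pairOn_swap_mul (hmap g hg)] at h
  simp only [sum_add_distrib, sum_sub_distrib, ← mul_sum, sum_const, nsmul_eq_mul,
    sum_fixOn (one_le_two.trans hB) hH hmap] at h
  have hm : (4 * ((#B : ℝ) - 1)) ≠ 0 := by
    have : (2 : ℝ) ≤ #B := by exact_mod_cast hB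
    linarith
  exact mul_left_cancel₀ hm (by linear_combination -h)

theorem fixOn_mul_comm [Fintype α] (g h : Perm α) :
    fixOn univ (g * h) = fixOn univ (h * g) := by
  refine Fintype.sum_equiv h _ _ fun a => ?_
  simp only [Perm.mul_apply, delta_apply_apply]

theorem pairOn_mul_comm [Fintype α] (g h : Perm α) :
    pairOn univ (g * h) = pairOn univ (h * g) := by
  rw [pairOn, pairOn, fixOn_mul_comm g h, mul_assoc g h, fixOn_mul_comm g, mul_assoc, mul_assoc,
    mul_assoc]

theorem fixOn_mul_self_eq [Fintype α] (g : Perm α) :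
    fixOn univ (g * g) = fixOn univ g + 2 * (Multiset.count 2 g.cycleType : ℝ) := by
  have hcount : Multiset.count 2 g.cycleType = #{c ∈ g.cycleFactorsFinset | #c.support = 2} := by
    rw [Perm.cycleType_def, Multiset.count_map]
    simp only [eq_comm (a := 2)]
    rfl
  have hunion : ({a | g (g a) = a ∧ g a ≠ a} : Finset α) =
      {c ∈ g.cycleFactorsFinset | #c.support = 2}.biUnion Perm.support := by
    ext a
    simp only [mem_filter, mem_univ, true_and, mem_biUnion]
    constructor
    · rintro ⟨h2, h1⟩
      refine ⟨g.cycleOf a, ⟨?_, ?_⟩, ?_⟩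
      · exact Perm.cycleOf_mem_cycleFactorsFinset_iff.2 (Perm.mem_support.2 h1)
      · have hc := (Perm.isCycle_cycleOf g h1).eq_swap_of_apply_apply_eq_self (x := a)
          (by simpa using h1) (by simpa using h2)
        rw [hc, Perm.card_support_eq_two]
        exact ⟨a, _, by simpa using Ne.symm h1, rfl⟩
      · simpa using h1
    · rintro ⟨c, ⟨hc, hc2⟩, ha⟩
      have hcg := (Perm.mem_cycleFactorsFinset_iff.1 hc).2
      obtain ⟨x, y, -, rfl⟩ := Perm.card_support_eq_two.1 hc2
      rw [← hcg a ha, ← hcg _ (Perm.apply_mem_support.2 ha)]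
      exact ⟨swap_apply_self _ _ _, Perm.mem_support.1 ha⟩
  have hcard : #({a | g (g a) = a ∧ g a ≠ a} : Finset α) = 2 * Multiset.count 2 g.cycleType := by
    rw [hunion, card_biUnion, hcount, sum_congr rfl fun c hc => (mem_filter.1 hc).2, sum_const,
      smul_eq_mul, mul_comm]
    intro c hc d hd hcd
    exact (g.cycleFactorsFinset_pairwise_disjoint (mem_filter.1 hc).1
      (mem_filter.1 hd).1 hcd).disjoint_support
  have hsum : ((#({a | g (g a) = a ∧ g a ≠ a} : Finset α) : ℕ) : ℝ) =
      fixOn univ (g * g) - fixOn univ g := by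
    rw [card_filter, fixOn, fixOn, ← sum_sub_distrib]
    push_cast
    refine sum_congr rfl fun a _ => ?_
    by_cases h : g a = a
    · simp [delta, h]
    · by_cases h' : g (g a) = a <;> simp [delta, h, h']
  rw [hcard] at hsum
  push_cast at hsum
  linarith

end Delta

section Block

open Equiv Finset

variable {n r : ℕ}

/-- The elements of the subgroup `blockSubgroup n r`. -/
def blockPerms (n r : ℕ) : Finset (Perm (Fin n)) := {g | g ∈ blockSubgroup n r}

theorem mem_blockPerms {g : Perm (Fin n)} : g ∈ blockPerms n r ↔ g ∈ blockSubgroup n r := by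
  simp [blockPerms]

theorem mem_blockSubgroup_iff {g : Perm (Fin n)} :
    g ∈ blockSubgroup n r ↔ ∀ a, (g a : ℕ) < r ↔ (a : ℕ) < r := by
  rw [blockSubgroup, MulAction.mem_stabilizer_set]
  rfl

theorem swap_mem_blockSubgroup_iff {i j : Fin n} :
    swap i j ∈ blockSubgroup n r ↔ ((i : ℕ) < r ↔ (j : ℕ) < r) := by
  rw [mem_blockSubgroup_iff]
  constructor
  · intro h
    simpa using (h i).symm
  · intro h a
    rw [swap_apply_def]
    split_ifs with h1 h2
    · rw [h1, h]
    · rw [h2, h]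
    · rfl

/-- The first `r` elements of `Fin n`. -/
def lowBlock (n r : ℕ) : Finset (Fin n) := {a | (a : ℕ) < r}

/-- The last `n - r` elements of `Fin n`. -/
def highBlock (n r : ℕ) : Finset (Fin n) := {a | ¬ (a : ℕ) < r}

theorem card_lowBlock (h : r ≤ n) : #(lowBlock n r) = r := by
  rw [lowBlock, Fin.card_filter_val_lt, min_eq_right h]

theorem card_highBlock (h : r ≤ n) : #(highBlock n r) = n - r := by
  have := card_filter_add_card_filter_not (s := (univ : Finset (Fin n))) (fun a => (a : ℕ) < r)
  have h1 := card_lowBlock h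
  rw [lowBlock] at h1
  rw [h1, card_univ, Fintype.card_fin] at this
  rw [highBlock]
  omega

theorem card_blockPerms (h : r ≤ n) :
    #(blockPerms n r) = Nat.factorial r * Nat.factorial (n - r) := by
  have h1 := DomMulAct.stabilizer_card (fun a : Fin n => decide ((a : ℕ) < r))
  have h2 : Fintype.card {a : Fin n // decide ((a : ℕ) < r) = true} = r := by
    rw [Fintype.card_subtype]
    simpa [lowBlock] using card_lowBlock h
  have h3 : Fintype.card {a : Fin n // decide ((a : ℕ) < r) = false} = n - r := by
    rw [Fintype.card_subtype]
    simpa [highBlock] using card_highBlock h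
  rw [Fintype.prod_bool, h2, h3, Fintype.card_subtype] at h1
  rw [← h1, blockPerms]
  congr 1
  ext g
  simp [mem_blockSubgroup_iff, funext_iff]

theorem swap_mul_mem_blockPerms {i j : Fin n} (hij : (i : ℕ) < r ↔ (j : ℕ) < r)
    {g : Perm (Fin n)} (hg : g ∈ blockPerms n r) : swap i j * g ∈ blockPerms n r :=
  mem_blockPerms.2 (mul_mem (swap_mem_blockSubgroup_iff.2 hij) (mem_blockPerms.1 hg))

theorem swap_mul_mem_of_lowBlock : ∀ i ∈ lowBlock n r, ∀ j ∈ lowBlock n r,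
    ∀ g ∈ blockPerms n r, swap i j * g ∈ blockPerms n r := by
  intro i hi j hj g hg
  simp only [lowBlock, mem_filter, mem_univ, true_and] at hi hj
  exact swap_mul_mem_blockPerms (by simp [hi, hj]) hg

theorem swap_mul_mem_of_highBlock : ∀ i ∈ highBlock n r, ∀ j ∈ highBlock n r,
    ∀ g ∈ blockPerms n r, swap i j * g ∈ blockPerms n r := by
  intro i hi j hj g hg
  simp only [highBlock, mem_filter, mem_univ, true_and] at hi hj
  exact swap_mul_mem_blockPerms (by simp [hi, hj]) hg

theorem apply_mem_lowBlock : ∀ g ∈ blockPerms n r, ∀ a ∈ lowBlock n r, g a ∈ lowBlock n r := by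
  intro g hg a ha
  simpa [lowBlock, mem_blockSubgroup_iff.1 (mem_blockPerms.1 hg) a] using ha

theorem apply_mem_highBlock :
    ∀ g ∈ blockPerms n r, ∀ a ∈ highBlock n r, g a ∈ highBlock n r := by
  intro g hg a ha
  have := mem_blockSubgroup_iff.1 (mem_blockPerms.1 hg) a
  simp only [highBlock, mem_filter, mem_univ, true_and] at ha ⊢
  rwa [this]

theorem fixOn_univ_eq_add (r : ℕ) (g : Perm (Fin n)) :
    fixOn univ g = fixOn (lowBlock n r) g + fixOn (highBlock n r) g :=
  (sum_filter_add_sum_filter_not _ _ _).symm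

/-- The character `fix - 1`. -/
def chi1 (g : Perm (Fin n)) : ℝ := fixOn univ g - 1

/-- The character `fix * (fix - 3) / 2 + t₂`. -/
def chi2 (g : Perm (Fin n)) : ℝ := (pairOn univ g - 4 * fixOn univ g) / 2

theorem fixCount_eq (g : Perm (Fin n)) : (fixCount g : ℝ) = fixOn univ g := by
  simp [fixCount, fixOn, delta]

theorem fixCount_sub_one_eq (g : Perm (Fin n)) : (fixCount g : ℝ) - 1 = chi1 g := by
  rw [fixCount_eq, chi1]

theorem fixCount_add_twoCycleCount_eq (g : Perm (Fin n)) :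
    (1 / 2 : ℝ) * (fixCount g : ℝ) * ((fixCount g : ℝ) - 3) + (twoCycleCount g : ℝ) = chi2 g := by
  rw [fixCount_eq, twoCycleCount, chi2, pairOn, fixOn_mul_self_eq]
  ring

theorem sum_chi1_swap_mul (g : Perm (Fin n)) (hn : n ≠ 0) :
    ∑ i, ∑ j, chi1 (swap i j * g) = (n : ℝ) ^ 2 * (1 - 2 / n) * chi1 g := by
  have h := sum_fixOn_swap_mul (B := univ) (g := g) (by simp)
  simp only [chi1, sum_sub_distrib, h, sum_const, card_univ, Fintype.card_fin, nsmul_eq_mul]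
  field_simp
  ring

theorem sum_chi2_swap_mul (g : Perm (Fin n)) (hn : n ≠ 0) :
    ∑ i, ∑ j, chi2 (swap i j * g) = (n : ℝ) ^ 2 * (1 - 2 / n) ^ 2 * chi2 g := by
  have h := sum_fixOn_swap_mul (B := univ) (g := g) (by simp)
  have h' := sum_pairOn_swap_mul (B := univ) (g := g) (by simp)
  simp only [chi2, ← sum_div, sum_sub_distrib, ← mul_sum, h, h', card_univ, Fintype.card_fin]
  field_simp
  ring

theorem sum_chi1_univ (hn : 1 ≤ n) : ∑ g : Perm (Fin n), chi1 g = 0 := by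
  have h := sum_fixOn (H := (univ : Finset (Perm (Fin n)))) (B := univ) (by simpa using hn)
    (by simp) (by simp)
  simp [chi1, sum_sub_distrib, h]

theorem sum_chi2_univ (hn : 2 ≤ n) : ∑ g : Perm (Fin n), chi2 g = 0 := by
  have h := sum_fixOn (H := (univ : Finset (Perm (Fin n)))) (B := univ)
    (by simpa using one_le_two.trans hn) (by simp) (by simp)
  have h' := sum_pairOn (H := (univ : Finset (Perm (Fin n)))) (B := univ) (by simpa using hn)
    (by simp) (by simp)
  simp only [chi2, ← sum_div, sum_sub_distrib, ← mul_sum, h, h', sub_self, zero_div]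

theorem sum_chi1_blockPerms (hr : 1 ≤ r) (hrn : r + 1 ≤ n) :
    ∑ g ∈ blockPerms n r, chi1 g = #(blockPerms n r) := by
  have h1 := sum_fixOn (by rw [card_lowBlock (by omega)]; omega)
    (swap_mul_mem_of_lowBlock (n := n) (r := r)) apply_mem_lowBlock
  have h2 := sum_fixOn (by rw [card_highBlock (by omega)]; omega)
    (swap_mul_mem_of_highBlock (n := n) (r := r)) apply_mem_highBlock
  simp only [chi1, fixOn_univ_eq_add r, sum_sub_distrib, sum_add_distrib, h1, h2, sum_const,
    nsmul_eq_mul]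
  ring

theorem fixOn_highBlock_swap_mul : ∀ i ∈ lowBlock n r, ∀ j ∈ lowBlock n r, ∀ g ∈ blockPerms n r,
    fixOn (highBlock n r) (swap i j * g) = fixOn (highBlock n r) g := by
  intro i hi j hj g hg
  refine sum_congr rfl fun a ha => ?_
  have hga := apply_mem_highBlock g hg a ha
  simp only [lowBlock, highBlock, mem_filter, mem_univ, true_and] at hi hj hga
  rw [Perm.mul_apply, swap_apply_of_ne_of_ne]
  · rintro rfl; exact hga hi
  · rintro rfl; exact hga hj

theorem sum_chi2_blockPerms (hr : 2 ≤ r) (hrn : r + 2 ≤ n) :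
    ∑ g ∈ blockPerms n r, chi2 g = #(blockPerms n r) := by
  have hl : 2 ≤ #(lowBlock n r) := by rw [card_lowBlock (by omega)]; omega
  have hh : 2 ≤ #(highBlock n r) := by rw [card_highBlock (by omega)]; omega
  have h1 := sum_fixOn (one_le_two.trans hl) (swap_mul_mem_of_lowBlock (n := n) (r := r))
    apply_mem_lowBlock
  have h2 := sum_fixOn (one_le_two.trans hh) (swap_mul_mem_of_highBlock (n := n) (r := r))
    apply_mem_highBlock
  have h3 := sum_pairOn hl (swap_mul_mem_of_lowBlock (n := n) (r := r)) apply_mem_lowBlock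
  have h4 := sum_pairOn hh (swap_mul_mem_of_highBlock (n := n) (r := r)) apply_mem_highBlock
  have h5 := sum_fixOn_mul (one_le_two.trans hl) (swap_mul_mem_of_lowBlock (n := n) (r := r))
    apply_mem_lowBlock _ fixOn_highBlock_swap_mul
  have h6 : ∀ g : Perm (Fin n), chi2 g =
      (pairOn (lowBlock n r) g + pairOn (highBlock n r) g
        + 2 * (fixOn (lowBlock n r) g * fixOn (highBlock n r) g)
        - 4 * fixOn (lowBlock n r) g - 4 * fixOn (highBlock n r) g) / 2 := by
    intro g
    simp only [chi2, pairOn, fixOn_univ_eq_add r]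
    ring
  simp only [h6, ← sum_div, sum_sub_distrib, sum_add_distrib, ← mul_sum, h1, h2, h3, h4, h5]
  ring

theorem sum_lt_iff_lt (h : r ≤ n) :
    (∑ i : Fin n, ∑ j : Fin n, if ((i : ℕ) < r ↔ (j : ℕ) < r) then (1 : ℝ) else 0) =
      ((n ^ 2 - 2 * r * (n - r) : ℕ) : ℝ) := by
  have h1 : ∀ i j : Fin n, (if ((i : ℕ) < r ↔ (j : ℕ) < r) then (1 : ℝ) else 0) =
      (if (i : ℕ) < r then 1 else 0) * (if (j : ℕ) < r then 1 else 0)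
      + (if ¬ (i : ℕ) < r then 1 else 0) * (if ¬ (j : ℕ) < r then 1 else 0) := by
    intro i j
    by_cases hi : (i : ℕ) < r <;> by_cases hj : (j : ℕ) < r <;> simp [hi, hj]
  have h2 : (∑ i : Fin n, if (i : ℕ) < r then (1 : ℝ) else 0) = r := by
    rw [sum_boole, ← lowBlock, card_lowBlock h]
  have h3 : (∑ i : Fin n, if ¬ (i : ℕ) < r then (1 : ℝ) else 0) = (n - r : ℕ) := by
    rw [sum_boole, ← highBlock, card_highBlock h]
  simp only [h1, sum_add_distrib, ← mul_sum, ← sum_mul, h2, h3]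
  obtain ⟨m, rfl⟩ := Nat.exists_eq_add_of_le h
  have : (r + m) ^ 2 - 2 * r * (r + m - r) = r ^ 2 + m ^ 2 := by
    rw [Nat.add_sub_cancel_left]
    apply Nat.sub_eq_of_eq_add
    ring
  rw [this, Nat.add_sub_cancel_left]
  push_cast
  ring

theorem swap_mul_swap_mem_blockSubgroup_iff {p q i j : Fin n} (hp : (p : ℕ) < r)
    (hq : r ≤ (q : ℕ)) :
    swap i j * swap p q ∈ blockSubgroup n r ↔ (i = p ∧ j = q) ∨ (i = q ∧ j = p) := by
  constructor
  · intro h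
    have h1 := mem_blockSubgroup_iff.1 h p
    have h2 := mem_blockSubgroup_iff.1 h q
    rw [Perm.mul_apply, swap_apply_left, swap_apply_def] at h1
    rw [Perm.mul_apply, swap_apply_right, swap_apply_def] at h2
    grind
  · rintro (⟨rfl, rfl⟩ | ⟨rfl, rfl⟩)
    · simp
    · rw [swap_comm]; simp

theorem mul_Q_eq_sum (h : r ≤ n) (hn : n ≠ 0) (g : Perm (Fin n)) :
    (n : ℝ) ^ 2 * #(blockPerms n r) * Q n r g =
      ∑ i, ∑ j, if swap i j * g ∈ blockSubgroup n r then (1 : ℝ) else 0 := by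
  have hfac : ((Nat.factorial r * Nat.factorial (n - r) : ℕ) : ℝ) ≠ 0 := by positivity
  rw [card_blockPerms h, Q]
  split_ifs with hg hc
  · simp only [mul_mem_cancel_right hg, swap_mem_blockSubgroup_iff]
    rw [sum_lt_iff_lt h, Nat.cast_mul (n ^ 2), Nat.cast_pow]
    field_simp
  · obtain ⟨p, q, hp, hq, κ, hκ, rfl⟩ := hc
    have hpq : p ≠ q := by rintro rfl; omega
    have : ∀ i j : Fin n, (if swap i j * (swap p q * κ) ∈ blockSubgroup n r then (1 : ℝ) else 0) =
        delta i p * delta j q + delta i q * delta j p := by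
      intro i j
      rw [← mul_assoc, mul_mem_cancel_right hκ, swap_mul_swap_mem_blockSubgroup_iff hp hq]
      simp only [delta]
      grind
    simp only [this, sum_add_distrib, ← mul_sum, sum_delta (mem_univ _), mul_one]
    rw [Nat.cast_mul (n ^ 2), Nat.cast_pow]
    field_simp
    norm_num
  · have : ∀ i j : Fin n, swap i j * g ∉ blockSubgroup n r := by
      intro i j hij
      have hg' : g = swap i j * (swap i j * g) := by simp
      by_cases h1 : (i : ℕ) < r <;> by_cases h2 : (j : ℕ) < r
      · exact hg ((mul_mem_cancel_left (swap_mem_blockSubgroup_iff.2 (by simp [h1, h2]))).1 hij)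
      · exact hc ⟨i, j, h1, not_lt.1 h2, _, hij, hg'⟩
      · exact hc ⟨j, i, h2, not_lt.1 h1, _, hij, by rw [swap_comm j i]; exact hg'⟩
      · exact hg ((mul_mem_cancel_left (swap_mem_blockSubgroup_iff.2 (by simp [h1, h2]))).1 hij)
    simp [this]

/-- The average of `χ` over the left coset of `g`. -/
def cosetAverage (n r : ℕ) (χ : Perm (Fin n) → ℝ) (g : Perm (Fin n)) : ℝ :=
  (∑ κ ∈ blockPerms n r, χ (g * κ)) / #(blockPerms n r)

theorem card_blockPerms_ne_zero : (#(blockPerms n r) : ℝ) ≠ 0 := by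
  rw [Nat.cast_ne_zero, ← Nat.pos_iff_ne_zero, card_pos]
  exact ⟨1, mem_blockPerms.2 (one_mem _)⟩

theorem cosetAverage_mul_of_mem {χ : Perm (Fin n) → ℝ} (hχ : ∀ g h, χ (g * h) = χ (h * g))
    {κ : Perm (Fin n)} (hκ : κ ∈ blockPerms n r) (g : Perm (Fin n)) :
    cosetAverage n r χ (κ * g) = cosetAverage n r χ g := by
  rw [cosetAverage, cosetAverage]
  congr 1
  refine sum_nbij' (· * κ) (· * κ⁻¹) ?_ ?_ (by simp) (by simp) ?_
  · intro a ha
    exact mem_blockPerms.2 (mul_mem (mem_blockPerms.1 ha) (mem_blockPerms.1 hκ))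
  · intro a ha
    exact mem_blockPerms.2 (mul_mem (mem_blockPerms.1 ha) (inv_mem (mem_blockPerms.1 hκ)))
  · intro a _
    rw [mul_assoc, hχ, mul_assoc]

theorem sum_cosetAverage_swap_mul {χ : Perm (Fin n) → ℝ} {c : ℝ}
    (hc : ∀ g, ∑ i, ∑ j, χ (swap i j * g) = c * χ g) (g : Perm (Fin n)) :
    ∑ i, ∑ j, cosetAverage n r χ (swap i j * g) = c * cosetAverage n r χ g := by
  simp only [cosetAverage, ← sum_div, mul_assoc]
  rw [sum_comm_three, sum_congr rfl fun κ _ => hc (g * κ), ← mul_sum, mul_div_assoc]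

theorem sum_Q_mul_cosetAverage (h : r ≤ n) (hn : n ≠ 0) {χ : Perm (Fin n) → ℝ} {l : ℝ}
    (hχ : ∀ g h, χ (g * h) = χ (h * g))
    (hl : ∀ g, ∑ i, ∑ j, χ (swap i j * g) = (n : ℝ) ^ 2 * l * χ g) (g : Perm (Fin n)) :
    ∑ x, Q n r x * cosetAverage n r χ (x * g) = l * cosetAverage n r χ g := by
  have hN : (n : ℝ) ^ 2 * #(blockPerms n r) ≠ 0 :=
    mul_ne_zero (by positivity) card_blockPerms_ne_zero
  refine mul_left_cancel₀ hN ?_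
  calc (n : ℝ) ^ 2 * #(blockPerms n r) * ∑ x, Q n r x * cosetAverage n r χ (x * g)
      = ∑ x, ∑ i, ∑ j, (if swap i j * x ∈ blockSubgroup n r then
          cosetAverage n r χ (x * g) else 0) := by
        rw [mul_sum]
        refine sum_congr rfl fun x _ => ?_
        rw [← mul_assoc, mul_Q_eq_sum h hn]
        simp only [sum_mul, ite_mul, one_mul, zero_mul]
    _ = ∑ i, ∑ j, ∑ x, (if x ∈ blockSubgroup n r then
          cosetAverage n r χ (swap i j * (x * g)) else 0) := by
        rw [← sum_comm_three]
        refine sum_congr rfl fun i _ => sum_congr rfl fun j _ => ?_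
        refine Fintype.sum_equiv (Equiv.mulLeft (swap i j)) _ _ fun x => ?_
        simp [← mul_assoc]
    _ = ∑ x ∈ blockPerms n r, ∑ i, ∑ j, cosetAverage n r χ (swap i j * (x * g)) := by
        rw [← sum_comm_three]
        simp only [blockPerms, sum_filter]
    _ = ∑ x ∈ blockPerms n r, (n : ℝ) ^ 2 * l * cosetAverage n r χ g := by
        refine sum_congr rfl fun x hx => ?_
        rw [sum_cosetAverage_swap_mul hl, cosetAverage_mul_of_mem hχ hx]
    _ = (n : ℝ) ^ 2 * #(blockPerms n r) * (l * cosetAverage n r χ g) := by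
        rw [sum_const, nsmul_eq_mul]
        ring

theorem sum_conv_mul {G : Type*} [Group G] [Fintype G] (μ ν φ : G → ℝ) :
    ∑ g, conv μ ν g * φ g = ∑ g, ν g * ∑ h, μ h * φ (h * g) := by
  simp only [conv, sum_mul, mul_sum]
  rw [sum_comm, sum_comm (s := univ) (t := univ) (f := fun g h => ν g * (μ h * φ (h * g)))]
  refine sum_congr rfl fun h _ => ?_
  refine Fintype.sum_equiv (Equiv.mulLeft h⁻¹) _ _ fun g => ?_
  simp only [coe_mulLeft, mul_inv_cancel_left]
  ring

theorem sum_convPow_mul {G : Type*} [Group G] [Fintype G] {μ φ : G → ℝ} {l : ℝ}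
    (hl : ∀ g, ∑ h, μ h * φ (h * g) = l * φ g) (k : ℕ) :
    ∑ g, convPow μ k g * φ g = l ^ k * φ 1 := by
  induction k with
  | zero => simp [convPow]
  | succ k ih =>
    simp only [convPow, sum_conv_mul, hl]
    rw [pow_succ', mul_assoc, ← ih, mul_sum]
    exact sum_congr rfl fun g _ => by ring

theorem sum_induced_mul {G : Type*} [Group G] [Fintype G] (H : Subgroup G) (μ : G → ℝ)
    (φ : G ⧸ H → ℝ) : ∑ x, induced H μ x * φ x = ∑ g, μ g * φ g := by
  simp only [induced, sum_mul, ite_mul, zero_mul]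
  rw [sum_comm]
  simp

theorem sum_coset_div_eq_cosetAverage (h : r ≤ n) (χ : Perm (Fin n) → ℝ) (g : Perm (Fin n)) :
    (∑ x : Perm (Fin n),
      if (x : Perm (Fin n) ⧸ blockSubgroup n r) = (g : Perm (Fin n) ⧸ blockSubgroup n r) then χ x
      else 0) / ((Nat.factorial r * Nat.factorial (n - r) : ℕ) : ℝ) = cosetAverage n r χ g := by
  rw [cosetAverage, card_blockPerms h, blockPerms, sum_filter]
  congr 1
  refine (Fintype.sum_equiv (Equiv.mulLeft g) _ _ fun x => ?_).symm
  simp [eq_comm (a := ((g * x : Perm (Fin n)) : Perm (Fin n) ⧸ blockSubgroup n r)),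
    QuotientGroup.eq]

theorem sum_unif_mul_eq_zero {G : Type*} [Group G] [Fintype G] (H : Subgroup G) {χ : G → ℝ}
    (hχ : ∑ g, χ g = 0) (c : ℝ) :
    ∑ x : G ⧸ H, unif (G ⧸ H) x * ((∑ g : G, if (g : G ⧸ H) = x then χ g else 0) / c) = 0 := by
  simp only [unif, ← mul_sum, ← sum_div]
  rw [sum_comm]
  simp [hχ]

theorem sum_induced_convPow_Q (h : r ≤ n) (hn : n ≠ 0) {χ : Perm (Fin n) → ℝ} {l : ℝ}
    (hχ : ∀ g h, χ (g * h) = χ (h * g))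
    (hl : ∀ g, ∑ i, ∑ j, χ (swap i j * g) = (n : ℝ) ^ 2 * l * χ g)
    (h1 : ∑ g ∈ blockPerms n r, χ g = #(blockPerms n r)) (k : ℕ) :
    ∑ x : Perm (Fin n) ⧸ blockSubgroup n r,
      induced (blockSubgroup n r) (convPow (Q n r) k) x *
        ((∑ g : Perm (Fin n), if (g : Perm (Fin n) ⧸ blockSubgroup n r) = x then χ g else 0) /
          ((Nat.factorial r * Nat.factorial (n - r) : ℕ) : ℝ)) = l ^ k := by
  rw [sum_induced_mul]
  simp only [sum_coset_div_eq_cosetAverage h]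
  rw [sum_convPow_mul (sum_Q_mul_cosetAverage h hn hχ hl)]
  simp only [cosetAverage, one_mul, h1, div_self card_blockPerms_ne_zero, mul_one]

theorem chi1_mul_comm (g h : Perm (Fin n)) : chi1 (g * h) = chi1 (h * g) := by
  rw [chi1, chi1, fixOn_mul_comm]

theorem chi2_mul_comm (g h : Perm (Fin n)) : chi2 (g * h) = chi2 (h * g) := by
  rw [chi2, chi2, pairOn_mul_comm, fixOn_mul_comm]

end Block

/-- expectations of the spherical functions `s₁`, `s₂` under the
uniform measure and under `Q̃^{*k}`. -/
theorem spherical_function_expectations (n r : ℕ) (hn : 2 ≤ n) (hr : 1 ≤ r)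
    (hrn : 2 * r ≤ n) (k : ℕ) :
    (∑ x : Equiv.Perm (Fin n) ⧸ blockSubgroup n r,
        unif (Equiv.Perm (Fin n) ⧸ blockSubgroup n r) x * s1 n r x = 0) ∧
    (∑ x : Equiv.Perm (Fin n) ⧸ blockSubgroup n r,
        induced (blockSubgroup n r) (convPow (Q n r) k) x * s1 n r x
          = (1 - 2/(n : ℝ))^k) ∧
    (2 ≤ r →
      (∑ x : Equiv.Perm (Fin n) ⧸ blockSubgroup n r,
          unif (Equiv.Perm (Fin n) ⧸ blockSubgroup n r) x * s2 n r x = 0) ∧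
      (∑ x : Equiv.Perm (Fin n) ⧸ blockSubgroup n r,
          induced (blockSubgroup n r) (convPow (Q n r) k) x * s2 n r x
            = (1 - 2/(n : ℝ))^(2*k))) := by
  have hrn' : r ≤ n := by omega
  have hn' : n ≠ 0 := by omega
  simp only [s1, s2, fixCount_sub_one_eq, fixCount_add_twoCycleCount_eq]
  refine ⟨sum_unif_mul_eq_zero _ (sum_chi1_univ (by omega)) _,
    sum_induced_convPow_Q hrn' hn' chi1_mul_comm (fun g => sum_chi1_swap_mul g hn')
      (sum_chi1_blockPerms hr (by omega)) k,
    fun hr2 => ⟨sum_unif_mul_eq_zero _ (sum_chi2_univ hn) _, ?_⟩⟩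
  rw [pow_mul]
  exact sum_induced_convPow_Q hrn' hn' chi2_mul_comm (fun g => sum_chi2_swap_mul g hn')
    (sum_chi2_blockPerms hr2 (by omega)) k

end BL
end
end

section
/- For all integers n ≥ 3 and r with 1 ≤ r and 2r ≤ n, and every x ∈ X, one has s₁(x)² = 1/(n−1) + ((n−2r)²/(r(n−r)(n−2)))·s₁(x) + (n²(r−1)(n−r−1)/(r(n−r)(n−1)(n−2)))·s₂(x). -/
open scoped Classical Pointwise

noncomputable section

namespace BL

section Transporter

lemma sum_eq_card_mul_of_const {ι : Type*} [Fintype ι] (T : Finset ι) (f : ι → ℝ) (q : ι)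
    (hT : ∀ i ∈ T, f i = f q) (h0 : ∀ i ∉ T, f i = 0) : ∑ i, f i = T.card * f q := by
  rw [← Finset.sum_subset (Finset.subset_univ T) fun i _ hi => h0 i hi,
    Finset.sum_congr rfl hT, Finset.sum_const, nsmul_eq_mul]

variable {ι : Type*} [DecidableEq ι]

/-- The indicator function of a finite set. -/
def ind (A : Finset ι) (i : ι) : ℝ := if i ∈ A then 1 else 0

lemma ind_sq (A : Finset ι) (i : ι) : ind A i ^ 2 = ind A i := by
  unfold ind; split_ifs <;> norm_num

variable [Fintype ι]

/-- The permutations carrying `A` onto `C`. -/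
def transporter (A C : Finset ι) : Finset (Equiv.Perm ι) :=
  Finset.univ.filter fun h => ∀ i, h i ∈ C ↔ i ∈ A

lemma mem_transporter {A C : Finset ι} {h : Equiv.Perm ι} :
    h ∈ transporter A C ↔ ∀ i, (h i ∈ C ↔ i ∈ A) := by
  simp [transporter]

/-- The number of permutations carrying `A` onto `C` and `i` to `p`. -/
def oneCount (A C : Finset ι) (i p : ι) : ℝ :=
  ∑ h ∈ transporter A C, if h i = p then 1 else 0

/-- The number of permutations carrying `A` onto `C`, `i` to `p` and `j` to `q`. -/
def pairCount (A C : Finset ι) (i j p q : ι) : ℝ :=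
  ∑ h ∈ transporter A C, if h i = p ∧ h j = q then 1 else 0

lemma sum_ind (A : Finset ι) : ∑ i, ind A i = (A.card : ℝ) := by
  simp [ind]

lemma sum_oneCount (A C : Finset ι) (i : ι) :
    ∑ p, oneCount A C i p = (transporter A C).card := by
  unfold oneCount
  rw [Finset.sum_comm]
  simp

lemma sum_pairCount (A C : Finset ι) (i j p : ι) :
    ∑ q, pairCount A C i j p q = oneCount A C i p := by
  unfold pairCount oneCount
  rw [Finset.sum_comm]
  refine Finset.sum_congr rfl fun h _ => ?_
  by_cases hp : h i = p <;> simp [hp]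

lemma swap_mul_mem_transporter {A C : Finset ι} {p q : ι} (hpq : p ∈ C ↔ q ∈ C)
    {h : Equiv.Perm ι} (hh : h ∈ transporter A C) :
    Equiv.swap p q * h ∈ transporter A C := by
  rw [mem_transporter] at hh ⊢
  intro i
  rw [← hh i, Equiv.Perm.mul_apply, Equiv.swap_apply_def]
  split_ifs with h1 h2
  · rw [h1, hpq]
  · rw [h2, hpq]
  · rfl

lemma pairCount_congr {A C : Finset ι} {i j p q q' : ι} (hq : q ∈ C ↔ q' ∈ C)
    (hpq : q ≠ p) (hpq' : q' ≠ p) : pairCount A C i j p q = pairCount A C i j p q' := by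
  unfold pairCount
  refine Finset.sum_nbij' (Equiv.swap q q' * ·) (Equiv.swap q q' * ·)
    (fun h hh => swap_mul_mem_transporter hq hh) (fun h hh => swap_mul_mem_transporter hq hh)
    (fun h _ => by simp [← mul_assoc]) (fun h _ => by simp [← mul_assoc]) fun h _ => ?_
  have e1 : (Equiv.swap q q' * h) i = p ↔ h i = p := by
    rw [Equiv.Perm.mul_apply, ← Equiv.eq_symm_apply, Equiv.symm_swap,
      Equiv.swap_apply_of_ne_of_ne hpq.symm hpq'.symm]
  have e2 : (Equiv.swap q q' * h) j = q' ↔ h j = q := by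
    rw [Equiv.Perm.mul_apply, ← Equiv.eq_symm_apply, Equiv.symm_swap, Equiv.swap_apply_right]
  simp only [e1, e2]

lemma oneCount_congr {A C : Finset ι} {i p p' : ι} (hp : p ∈ C ↔ p' ∈ C) :
    oneCount A C i p = oneCount A C i p' := by
  unfold oneCount
  refine Finset.sum_nbij' (Equiv.swap p p' * ·) (Equiv.swap p p' * ·)
    (fun h hh => swap_mul_mem_transporter hp hh) (fun h hh => swap_mul_mem_transporter hp hh)
    (fun h _ => by simp [← mul_assoc]) (fun h _ => by simp [← mul_assoc]) fun h _ => ?_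
  have e2 : (Equiv.swap p p' * h) i = p' ↔ h i = p := by
    rw [Equiv.Perm.mul_apply, ← Equiv.eq_symm_apply, Equiv.symm_swap, Equiv.swap_apply_right]
  simp only [e2]

lemma oneCount_eq_zero {A C : Finset ι} {i p : ι} (hp : ¬(p ∈ C ↔ i ∈ A)) :
    oneCount A C i p = 0 :=
  Finset.sum_eq_zero fun h hh => if_neg fun (e : h i = p) => hp (e ▸ mem_transporter.1 hh i)

lemma pairCount_eq_zero_left {A C : Finset ι} {i j p q : ι} (hp : ¬(p ∈ C ↔ i ∈ A)) :
    pairCount A C i j p q = 0 :=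
  Finset.sum_eq_zero fun h hh => if_neg fun (e : h i = p ∧ h j = q) =>
    hp (e.1 ▸ mem_transporter.1 hh i)

lemma pairCount_eq_zero_right {A C : Finset ι} {i j p q : ι} (hq : ¬(q ∈ C ↔ j ∈ A)) :
    pairCount A C i j p q = 0 :=
  Finset.sum_eq_zero fun h hh => if_neg fun (e : h i = p ∧ h j = q) =>
    hq (e.2 ▸ mem_transporter.1 hh j)

lemma pairCount_self {A C : Finset ι} {i j p : ι} (hij : i ≠ j) :
    pairCount A C i j p p = 0 :=
  Finset.sum_eq_zero fun h _ => if_neg fun e => hij (h.injective (e.1.trans e.2.symm))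

lemma card_filter_mem_iff (C : Finset ι) (P : Prop) [Decidable P] :
    ((Finset.univ.filter fun q => (q ∈ C ↔ P)).card : ℝ) =
      if P then (C.card : ℝ) else Fintype.card ι - C.card := by
  split_ifs with hP
  · simp [hP]
  · have : (Finset.univ.filter fun q => (q ∈ C ↔ P)) = Cᶜ := by ext; simp [hP]
    rw [this, Finset.card_compl, Nat.cast_sub (Finset.card_le_univ C)]

lemma transporter_card_eq_mul_oneCount {A C : Finset ι} {i p : ι} (hp : p ∈ C ↔ i ∈ A) :
    ((transporter A C).card : ℝ) =
      (if i ∈ A then (C.card : ℝ) else Fintype.card ι - C.card) * oneCount A C i p := by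
  rw [← card_filter_mem_iff, ← sum_oneCount A C i]
  refine sum_eq_card_mul_of_const _ _ _ (fun q hq => oneCount_congr ?_)
    fun q hq => oneCount_eq_zero ?_
  · rw [hp]; simpa using hq
  · simpa using hq

lemma oneCount_eq_mul_pairCount {A C : Finset ι} {i j p q : ι} (hij : i ≠ j) (hpq : p ≠ q)
    (hp : p ∈ C ↔ i ∈ A) (hq : q ∈ C ↔ j ∈ A) :
    oneCount A C i p = ((if j ∈ A then (C.card : ℝ) else Fintype.card ι - C.card) -
      if i ∈ A ↔ j ∈ A then 1 else 0) * pairCount A C i j p q := by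
  have hcard : ((((Finset.univ.filter fun q => (q ∈ C ↔ j ∈ A)).erase p).card : ℕ) : ℝ) =
      (if j ∈ A then (C.card : ℝ) else Fintype.card ι - C.card) -
        if i ∈ A ↔ j ∈ A then 1 else 0 := by
    rw [← card_filter_mem_iff]
    split_ifs with hs
    · rw [Finset.cast_card_erase_of_mem (by simp [hp, hs])]
    · rw [Finset.erase_eq_of_notMem (by simp [hp, hs]), sub_zero]
  rw [← hcard, ← sum_pairCount A C i j p]
  refine sum_eq_card_mul_of_const _ _ _ (fun q' hq' => ?_) fun q' hq' => ?_
  · simp only [Finset.mem_erase, Finset.mem_filter, Finset.mem_univ, true_and] at hq'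
    exact pairCount_congr (hq'.2.trans hq.symm) hq'.1 hpq.symm
  · by_cases h : q' = p
    · rw [h, pairCount_self hij]
    · exact pairCount_eq_zero_right fun e => hq' (by simp [h, e])

lemma oneCount_eq {A C : Finset ι} {r s : ℝ} (hr : (C.card : ℝ) = r)
    (hs : (Fintype.card ι : ℝ) - r = s) (hr0 : r ≠ 0) (hs0 : s ≠ 0) (i p : ι) :
    oneCount A C i p = (transporter A C).card *
      (ind A i * ind C p / r + (1 - ind A i) * (1 - ind C p) / s) := by
  by_cases hp : p ∈ C ↔ i ∈ A
  · rw [transporter_card_eq_mul_oneCount hp, hr, hs]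
    by_cases hi : i ∈ A <;> simp [ind, hi, hp] <;> field_simp
  · rw [oneCount_eq_zero hp]
    by_cases hi : i ∈ A <;> by_cases hc : p ∈ C <;> simp_all [ind]

lemma pairCount_eq {A C : Finset ι} {r s : ℝ} (hr : (C.card : ℝ) = r)
    (hs : (Fintype.card ι : ℝ) - r = s) (hr0 : r ≠ 0) (hs0 : s ≠ 0) (hr1 : r - 1 ≠ 0)
    (hs1 : s - 1 ≠ 0) {i j p q : ι} (hij : i ≠ j) (hpq : p ≠ q) :
    pairCount A C i j p q = (transporter A C).card *
      (ind A i * ind A j * ind C p * ind C q / (r * (r - 1)) +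
        (1 - ind A i) * (1 - ind A j) * (1 - ind C p) * (1 - ind C q) / (s * (s - 1)) +
        (ind A i * (1 - ind A j) * ind C p * (1 - ind C q) +
          (1 - ind A i) * ind A j * (1 - ind C p) * ind C q) / (r * s)) := by
  by_cases hp : p ∈ C ↔ i ∈ A
  · by_cases hq : q ∈ C ↔ j ∈ A
    · rw [transporter_card_eq_mul_oneCount hp, oneCount_eq_mul_pairCount hij hpq hp hq, hr,
        hs]
      by_cases hi : i ∈ A <;> by_cases hj : j ∈ A <;> simp [ind, hi, hj, hp, hq] <;> field_simp
    · rw [pairCount_eq_zero_right hq]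
      by_cases hi : j ∈ A <;> by_cases hc : q ∈ C <;> simp_all [ind]
  · rw [pairCount_eq_zero_left hp]
    by_cases hi : i ∈ A <;> by_cases hc : p ∈ C <;> simp_all [ind]

lemma sum_sum_ite_ne (f : ι → ι → ℝ) :
    ∑ i, ∑ j, (if i ≠ j then f i j else 0) = ∑ i, ∑ j, f i j - ∑ i, f i i := by
  rw [← Finset.sum_sub_distrib]
  refine Finset.sum_congr rfl fun i _ => ?_
  rw [eq_sub_iff_add_eq, ← Finset.sum_erase_add _ (fun j => f i j) (Finset.mem_univ i),
    ← Finset.sum_erase_add _ _ (Finset.mem_univ i)]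
  simp only [ne_eq, not_true, if_false, add_zero, add_left_inj]
  exact Finset.sum_congr rfl fun j hj => if_pos (Finset.ne_of_mem_erase hj).symm

end Transporter

lemma cycleOf_support_card_eq_two_iff {ι : Type*} [Fintype ι] [DecidableEq ι]
    {h : Equiv.Perm ι} {x : ι}
    (hx : h x ≠ x) : (h.cycleOf x).support.card = 2 ↔ h (h x) = x := by
  have hc := Equiv.Perm.isCycle_cycleOf h hx
  have hx' : h.cycleOf x x ≠ x := by rwa [Equiv.Perm.cycleOf_apply_self]
  have hsq : h (h x) = x ↔ h.cycleOf x ^ 2 = 1 := by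
    rw [hc.pow_eq_one_iff' hx', Equiv.Perm.cycleOf_pow_apply_self, pow_two, Equiv.Perm.mul_apply]
  rw [← hc.orderOf, hsq]
  exact ⟨fun e => e ▸ pow_orderOf_eq_one _, fun e => orderOf_eq_prime e hc.ne_one⟩

lemma two_mul_count_two_cycleType {ι : Type*} [Fintype ι] [DecidableEq ι] (h : Equiv.Perm ι) :
    2 * h.cycleType.count 2 = (Finset.univ.filter fun x => h x ≠ x ∧ h (h x) = x).card := by
  have hF : h.cycleType.count 2 =
      (h.cycleFactorsFinset.filter fun c => 2 = c.support.card).card := by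
    rw [Equiv.Perm.cycleType_def, Multiset.count_map]; rfl
  rw [hF, Finset.card_eq_sum_card_fiberwise (f := h.cycleOf)
    (t := h.cycleFactorsFinset.filter fun c => 2 = c.support.card), mul_comm, ← smul_eq_mul,
    ← Finset.sum_const]
  · refine Finset.sum_congr rfl fun c hc => ?_
    rw [Finset.mem_filter] at hc
    nth_rewrite 1 [hc.2]
    congr 1
    ext x
    rw [Finset.mem_filter, Finset.mem_filter, ← Equiv.Perm.eq_cycleOf_of_mem_cycleFactorsFinset_iff
      h c hc.1 x]
    refine ⟨fun hx => ⟨⟨Finset.mem_univ _, ?_⟩, hx.symm⟩, fun hx => hx.2.symm⟩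
    have hx1 : h x ≠ x := by
      rw [← Equiv.Perm.mem_support, ← Equiv.Perm.cycleOf_mem_cycleFactorsFinset_iff, ← hx]
      exact hc.1
    refine ⟨hx1, (cycleOf_support_card_eq_two_iff hx1).1 ?_⟩
    rw [← hx, ← hc.2]
  · intro x hx
    simp only [Finset.coe_filter, Finset.mem_univ, true_and, Set.mem_ofPred_eq] at hx ⊢
    exact ⟨Equiv.Perm.cycleOf_mem_cycleFactorsFinset_iff.2 (Equiv.Perm.mem_support.2 hx.1),
      ((cycleOf_support_card_eq_two_iff hx.1).2 hx.2).symm⟩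

lemma card_transporter_map {ι : Type*} [Fintype ι] [DecidableEq ι] (A : Finset ι)
    (g : Equiv.Perm ι) :
    (transporter A (A.map g.toEmbedding)).card =
      A.card.factorial * (Fintype.card ι - A.card).factorial := by
  have hA : (transporter A (A.map g.toEmbedding)).card =
      Fintype.card {h : Equiv.Perm ι // (fun i => decide (i ∈ A)) ∘ h = fun i => decide (i ∈ A)} := by
    rw [Fintype.card_subtype]
    refine Finset.card_nbij' (g⁻¹ * ·) (g * ·) ?_ ?_ (fun h _ => by simp) (fun h _ => by simp)
    · intro h hh
      simpa [mem_transporter, funext_iff, Finset.mem_map_equiv] using hh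
    · intro h hh
      simpa [mem_transporter, funext_iff, Finset.mem_map_equiv] using hh
  rw [hA, DomMulAct.stabilizer_card, Fintype.prod_bool, ← Finset.card_compl]
  congr 2
  · simp
  · rw [Fintype.card_subtype]
    congr 1
    ext; simp

section Sums

variable {n : ℕ}

lemma sum_fixCount (A C : Finset (Fin n)) :
    ∑ h ∈ transporter A C, (fixCount h : ℝ) = ∑ i, oneCount A C i i := by
  unfold oneCount
  rw [Finset.sum_comm]
  exact Finset.sum_congr rfl fun h _ => by simp [fixCount]

lemma fixCount_sq_sub_add (h : Equiv.Perm (Fin n)) :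
    (fixCount h : ℝ) ^ 2 - fixCount h + 2 * twoCycleCount h =
      ∑ i, ∑ j, if i ≠ j then
        ((if h i = i ∧ h j = j then 1 else 0) + (if h i = j ∧ h j = i then 1 else 0) : ℝ)
      else 0 := by
  have hfix : (fixCount h : ℝ) = ∑ i, if h i = i then 1 else 0 := by simp [fixCount]
  have htwo : (2 * twoCycleCount h : ℝ) = ∑ i, if h i ≠ i ∧ h (h i) = i then 1 else 0 := by
    have := two_mul_count_two_cycleType h
    rw [Finset.sum_boole, ← this, twoCycleCount]
    push_cast
    rfl
  rw [sum_sum_ite_ne, htwo, pow_two, hfix, Finset.sum_mul_sum]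
  simp only [Finset.sum_add_distrib]
  have h1 : ∀ i j, ((if h i = i then 1 else 0) * (if h j = j then 1 else 0) : ℝ) =
      if h i = i ∧ h j = j then 1 else 0 := fun i j => by
    rw [ite_and]; split_ifs <;> simp
  have h2 : ∀ i, ∑ j, (if h i = j ∧ h j = i then 1 else 0 : ℝ) =
      (if h i ≠ i ∧ h (h i) = i then 1 else 0) + if h i = i then 1 else 0 := fun i => by
    simp only [ite_and, Finset.sum_ite_eq, Finset.mem_univ, if_true]
    by_cases hi : h i = i <;> simp [hi]
  simp only [h1, h2, and_self, Finset.sum_add_distrib]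
  ring

lemma sum_fixCount_sq_sub_add (A C : Finset (Fin n)) :
    ∑ h ∈ transporter A C, ((fixCount h : ℝ) ^ 2 - fixCount h + 2 * twoCycleCount h) =
      ∑ i, ∑ j, if i ≠ j then pairCount A C i j i j + pairCount A C i j j i else 0 := by
  simp only [fixCount_sq_sub_add, pairCount]
  rw [Finset.sum_comm]
  refine Finset.sum_congr rfl fun i _ => ?_
  rw [Finset.sum_comm]
  refine Finset.sum_congr rfl fun j _ => ?_
  split_ifs <;> simp [Finset.sum_add_distrib]

variable {A C : Finset (Fin n)} {r s : ℝ}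

lemma sum_compl_mul_compl (hA : (A.card : ℝ) = r) (hC : (C.card : ℝ) = r) :
    ∑ i, (1 - ind A i) * (1 - ind C i) = n - 2 * r + ∑ i, ind A i * ind C i := by
  simp only [sub_mul, mul_sub, one_mul, mul_one, Finset.sum_sub_distrib, sum_ind, hA, hC]
  simp
  ring

lemma sum_fixCount_eq (hA : (A.card : ℝ) = r) (hC : (C.card : ℝ) = r) (hs : (n : ℝ) - r = s)
    (hr0 : r ≠ 0) (hs0 : s ≠ 0) :
    ∑ h ∈ transporter A C, (fixCount h : ℝ) = (transporter A C).card *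
      ((∑ i, ind A i * ind C i) / r + (s - r + ∑ i, ind A i * ind C i) / s) := by
  rw [sum_fixCount]
  simp only [oneCount_eq hC (by simpa using hs) hr0 hs0]
  rw [← Finset.mul_sum, Finset.sum_add_distrib, ← Finset.sum_div, ← Finset.sum_div,
    sum_compl_mul_compl hA hC, ← hs]
  ring

lemma sum_pairs_eq (hA : (A.card : ℝ) = r) (hC : (C.card : ℝ) = r) (hs : (n : ℝ) - r = s)
    (hr0 : r ≠ 0) (hs0 : s ≠ 0) (hr1 : r - 1 ≠ 0) (hs1 : s - 1 ≠ 0) {k m : ℝ}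
    (hk : ∑ i, ind A i * ind C i = k) (hm : s - r + k = m) :
    ∑ h ∈ transporter A C, ((fixCount h : ℝ) ^ 2 - fixCount h + 2 * twoCycleCount h) =
      (transporter A C).card * (2 * (k * (k - 1) / (r * (r - 1)) + m * (m - 1) / (s * (s - 1)) +
        (k * m + (r - k) ^ 2) / (r * s))) := by
  rw [sum_fixCount_sq_sub_add]
  set u : Fin n → ℝ := fun i => ind A i * ind C i with hu
  set v : Fin n → ℝ := fun i => (1 - ind A i) * (1 - ind C i) with hv
  set w : Fin n → ℝ := fun i => ind A i * (1 - ind C i) with hw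
  set z : Fin n → ℝ := fun i => (1 - ind A i) * ind C i with hz
  have su : ∑ i, u i = k := hk
  have sv : ∑ i, v i = m := by rw [hv, sum_compl_mul_compl hA hC, hk, ← hm, ← hs]; ring
  have sw : ∑ i, w i = r - k := by
    simp only [hw, mul_sub, mul_one, Finset.sum_sub_distrib, sum_ind, hA]
    rw [← hk]
  have sz : ∑ i, z i = r - k := by
    simp only [hz, sub_mul, one_mul, Finset.sum_sub_distrib, sum_ind, hC]
    rw [← hk]
  have hpair : ∀ i j, (if i ≠ j then pairCount A C i j i j + pairCount A C i j j i else 0) =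
      if i ≠ j then ((transporter A C).card : ℝ) * (2 * (u i * u j) / (r * (r - 1)) +
        2 * (v i * v j) / (s * (s - 1)) +
        (u i * v j + v i * u j + w i * z j + z i * w j) / (r * s)) else 0 := fun i j => by
    split_ifs with hij
    · rw [pairCount_eq hC (by simpa using hs) hr0 hs0 hr1 hs1 hij hij,
        pairCount_eq hC (by simpa using hs) hr0 hs0 hr1 hs1 hij (Ne.symm hij)]
      simp only [hu, hv, hw, hz]
      ring
    · rfl
  have hdiag : ∀ i, ((transporter A C).card : ℝ) * (2 * (u i * u i) / (r * (r - 1)) +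
        2 * (v i * v i) / (s * (s - 1)) +
        (u i * v i + v i * u i + w i * z i + z i * w i) / (r * s)) =
      (transporter A C).card * (2 * u i / (r * (r - 1)) + 2 * v i / (s * (s - 1))) := fun i => by
    simp only [hu, hv, hw, hz, ind]
    split_ifs <;> norm_num
  simp only [hpair]
  rw [sum_sum_ite_ne]
  simp only [hdiag, ← Finset.mul_sum, ← Finset.sum_div, Finset.sum_add_distrib,
    ← Finset.sum_mul, su, sv, sw, sz]
  ring

end Sums

lemma mem_blockSubgroup {n r : ℕ} {g : Equiv.Perm (Fin n)} :
    g ∈ blockSubgroup n r ↔ ∀ i, ((g i : ℕ) < r ↔ (i : ℕ) < r) := by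
  rw [blockSubgroup, MulAction.mem_stabilizer_set]
  rfl

/-- The first `r` positions. -/
def firstBlock (n r : ℕ) : Finset (Fin n) := Finset.univ.filter fun i => (i : ℕ) < r

lemma card_firstBlock {n r : ℕ} (h : r ≤ n) : (firstBlock n r).card = r := by
  simp [firstBlock, Fin.card_filter_val_lt, h]

lemma coset_eq_iff_mem_transporter {n r : ℕ} (g h : Equiv.Perm (Fin n)) :
    (h : Equiv.Perm (Fin n) ⧸ blockSubgroup n r) = g ↔
      h ∈ transporter (firstBlock n r) ((firstBlock n r).map g.toEmbedding) := by
  rw [eq_comm, QuotientGroup.eq, mem_blockSubgroup, mem_transporter]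
  simp [Finset.mem_map_equiv, firstBlock]

/-- the quadratic identity for the spherical function `s₁`. -/
theorem spherical_function_square_identity (n r : ℕ) (hn : 3 ≤ n) (hr : 1 ≤ r)
    (hrn : 2 * r ≤ n) (x : Equiv.Perm (Fin n) ⧸ blockSubgroup n r) :
    (s1 n r x)^2 =
      1 / ((n : ℝ) - 1) +
        (((n : ℝ) - 2*r)^2 / ((r : ℝ) * ((n : ℝ) - r) * ((n : ℝ) - 2))) * s1 n r x +
        (((n : ℝ)^2 * ((r : ℝ) - 1) * ((n : ℝ) - r - 1)) /
            ((r : ℝ) * ((n : ℝ) - r) * ((n : ℝ) - 1) * ((n : ℝ) - 2))) * s2 n r x := by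
  obtain ⟨g, rfl⟩ := QuotientGroup.mk_surjective x
  have hle : r ≤ n := by omega
  set A := firstBlock n r
  set C := A.map g.toEmbedding
  have hA : (A.card : ℝ) = r := by rw [card_firstBlock hle]
  have hC : (C.card : ℝ) = r := by rw [Finset.card_map, hA]
  have hN : (transporter A C).card = r.factorial * (n - r).factorial := by
    rw [card_transporter_map, card_firstBlock hle, Fintype.card_fin]
  have hN0 : ((transporter A C).card : ℝ) ≠ 0 := by
    rw [hN]; positivity
  have hr0 : (r : ℝ) ≠ 0 := by positivity
  have hs : (2 : ℝ) ≤ n - r := by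
    have : 2 + r ≤ n := by omega
    rw [le_sub_iff_add_le]; exact_mod_cast this
  have hn3 : (3 : ℝ) ≤ n := by exact_mod_cast hn
  have hs0 : (n : ℝ) - r ≠ 0 := by linarith
  have hs1 : (n : ℝ) - r - 1 ≠ 0 := by linarith
  have hn1 : (n : ℝ) - 1 ≠ 0 := by linarith
  have hn2 : (n : ℝ) - 2 ≠ 0 := by linarith
  set k := ∑ i, ind A i * ind C i
  have hfix := sum_fixCount_eq hA hC rfl hr0 hs0
  have e1 : s1 n r g = k / r + (n - r - r + k) / (n - r) - 1 := by
    unfold s1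
    rw [← hN, div_eq_iff hN0]
    simp only [coset_eq_iff_mem_transporter]
    rw [Finset.sum_ite_mem, Finset.univ_inter, Finset.sum_sub_distrib, hfix]
    simp only [Finset.sum_const, nsmul_eq_mul]
    ring
  by_cases hr1 : (r : ℝ) - 1 = 0
  · have hr1' : (r : ℝ) = 1 := by linarith
    have hk : k ^ 2 = k := by
      obtain ⟨a, ha⟩ := Finset.card_eq_one.1 (show A.card = 1 by exact_mod_cast hA.trans hr1')
      have hka : k = ind C a := by simp [k, ha, ind]
      rw [hka, ind_sq]
    rw [hr1, e1]
    simp only [hr1'] at hs0 ⊢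
    field_simp
    linear_combination (n : ℝ) ^ 2 * (n - 2) * hk
  · have e2 : s2 n r g = k * (k - 1) / (r * (r - 1)) +
        (n - r - r + k) * (n - r - r + k - 1) / ((n - r) * (n - r - 1)) +
        (k * (n - r - r + k) + (r - k) ^ 2) / (r * (n - r)) -
        (k / r + (n - r - r + k) / (n - r)) := by
      have hpairs := sum_pairs_eq hA hC rfl hr0 hs0 hr1 hs1 rfl rfl
      unfold s2
      rw [← hN, div_eq_iff hN0]
      simp only [coset_eq_iff_mem_transporter]
      rw [Finset.sum_ite_mem, Finset.univ_inter]
      have : ∀ h : Equiv.Perm (Fin n), (1/2 : ℝ) * (fixCount h : ℝ) * ((fixCount h : ℝ) - 3) +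
          (twoCycleCount h : ℝ) =
          1 / 2 * ((fixCount h : ℝ) ^ 2 - fixCount h + 2 * twoCycleCount h) - fixCount h :=
        fun h => by ring
      simp only [this]
      rw [Finset.sum_sub_distrib, ← Finset.mul_sum, hpairs, hfix]
      ring
    rw [e1, e2]
    field_simp
    ring

end BL
end
end

section
/- For all integers n ≥ 2 and r with 1 ≤ r and 2r ≤ n, one has Σ_{(j,ℓ,i,m)∈I} D(j,ℓ,m) = 2ⁿ·C(n,r). -/
/-- `D(j,ℓ,m) = C(n,j)·[C(j,ℓ) − C(j,ℓ−1)]·[C(n−j,m) − C(n−j,m−1)]`, with the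
convention `C(a,−1) = 0`. -/
noncomputable def D (n j l m : ℕ) : ℝ :=
  (n.choose j : ℝ) *
    ((j.choose l : ℝ) - if l = 0 then 0 else (j.choose (l-1) : ℝ)) *
    (((n-j).choose m : ℝ) - if m = 0 then 0 else ((n-j).choose (m-1) : ℝ))

theorem sum_range_choose_sub_choose_pred (a k : ℕ) :
    ∑ m ∈ Finset.range (k + 1),
      ((a.choose m : ℝ) - if m = 0 then 0 else (a.choose (m - 1) : ℝ)) = a.choose k := by
  induction k with
  | zero => simp
  | succ k ih => rw [Finset.sum_range_succ, ih]; simp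

theorem sum_range_min_choose_sub_choose_pred {a k : ℕ} (hk : k ≤ a) :
    ∑ m ∈ Finset.range (min k (a - k) + 1),
      ((a.choose m : ℝ) - if m = 0 then 0 else (a.choose (m - 1) : ℝ)) = a.choose k := by
  rw [sum_range_choose_sub_choose_pred]
  rcases min_choice k (a - k) with h | h <;> rw [h]
  rw [Nat.choose_symm hk]

theorem sum_Icc_choose_mul_choose {n r j : ℕ} (hj : j ≤ n) :
    ∑ i ∈ Finset.Icc (r - (n - j)) (min r j),
      (j.choose i : ℝ) * ((n - j).choose (r - i) : ℝ) = n.choose r := by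
  have h := Nat.add_choose_eq j (n - j) r
  rw [Nat.add_sub_cancel' hj, Finset.Nat.sum_antidiagonal_eq_sum_range_succ_mk] at h
  rw [h]
  push_cast
  refine Finset.sum_subset (fun i hi => ?_) (fun i hi hi' => ?_)
  · simp only [Finset.mem_Icc, Finset.mem_range] at *
    omega
  · simp only [Finset.mem_Icc, Finset.mem_range] at *
    rcases lt_or_ge j i with hij | hij
    · simp [Nat.choose_eq_zero_of_lt hij]
    · have : n - j < r - i := by omega
      simp [Nat.choose_eq_zero_of_lt this]

theorem sum_D_eq {n r j : ℕ} (hj : j ≤ n) :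
    (∑ l ∈ Finset.range (j/2 + 1),
      ∑ i ∈ Finset.Icc (max l (r - (n - j))) (min r (j - l)),
        ∑ m ∈ Finset.range (min (r - i) ((n - j) - (r - i)) + 1),
          D n j l m) = (n.choose j : ℝ) * n.choose r := by
  rw [Finset.sum_comm' (t' := Finset.Icc (r - (n - j)) (min r j))
    (s' := fun i => Finset.range (min i (j - i) + 1))
    (by intro l i; simp only [Finset.mem_Icc, Finset.mem_range]; omega),
    ← sum_Icc_choose_mul_choose (r := r) hj, Finset.mul_sum]
  refine Finset.sum_congr rfl fun i hi => ?_
  rw [Finset.mem_Icc] at hi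
  simp only [D, ← Finset.mul_sum, ← Finset.sum_mul]
  rw [sum_range_min_choose_sub_choose_pred (by omega),
    sum_range_min_choose_sub_choose_pred (by omega), mul_assoc]

/-- the total dimension count
`Σ_{(j,ℓ,i,m)∈I} D(j,ℓ,m) = 2ⁿ·C(n,r)`, where `I` is the index set of the
decomposition of `L(X)` for `X = (ℤ₂ ≀ Sₙ)/(S_r × S_{n−r})`. -/
theorem dimension_count (n r : ℕ) (hn : 2 ≤ n) (hr : 1 ≤ r) (hrn : 2 * r ≤ n) :
    (∑ j ∈ Finset.range (n+1), ∑ l ∈ Finset.range (j/2 + 1),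
      ∑ i ∈ Finset.Icc (max l (r - (n - j))) (min r (j - l)),
        ∑ m ∈ Finset.range (min (r - i) ((n - j) - (r - i)) + 1),
          D n j l m) = ((2^n * n.choose r : ℕ) : ℝ) := by
  rw [Finset.sum_congr rfl fun j hj => sum_D_eq (Nat.lt_succ_iff.mp (Finset.mem_range.mp hj)),
    ← Finset.sum_mul, ← Nat.sum_range_choose]
  push_cast
  rfl
end
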